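/- arXiv:1410.4233 — 2 statements merged into one kernel-verified Lean document; each statement's English description precedes it below -/
import Mathlib

section
/- Let (R, m) be an analytically unramified Cohen-Macaulay local ring of dimension d > 0 with infinite residue field, I an m-primary ideal, J a minimal reduction. If the Sally module S̄ of the normal filtration vanishes, then the associated graded ring ⊕_{n≥0} closure(I^n)/closure(I^{n+1}) of the normal filtration is Cohen-Macaulay. -/
set_option synthInstance.maxHeartbeats 1000000
set_option maxHeartbeats 2000000

open IsLocalRing Polynomial Finset

variable {R : Type*}

/-- `x` is integral over the ideal `I`: it satisfies an equation
`x^n + a₁ x^{n-1} + ⋯ + aₙ = 0` with `aᵢ ∈ Iⁱ`. -/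
def IsIntegralOverIdeal [CommRing R] (I : Ideal R) (x : R) : Prop :=
  ∃ n : ℕ, 0 < n ∧ ∃ a : ℕ → R, (∀ i ∈ Finset.Icc 1 n, a i ∈ I ^ i) ∧
    x ^ n + ∑ i ∈ Finset.Icc 1 n, a i * x ^ (n - i) = 0

/-- The integral closure of an ideal (the set of integral elements is an ideal,
so the span equals it). -/
def intCl [CommRing R] (I : Ideal R) : Ideal R :=
  Ideal.span {x | IsIntegralOverIdeal I x}

/-- Length of a module, as the Krull dimension of its lattice of submodules. -/
noncomputable def mlen (R M : Type*) [CommRing R] [AddCommGroup M] [Module R M] :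
    WithBot ℕ∞ :=
  Order.krullDim (Submodule R M)

/-- The quotient module `N/(K ∩ N)` for ideals `N K`. -/
abbrev idealQuot [CommRing R] (N K : Ideal R) :=
  N ⧸ (Submodule.comap N.subtype K)

/-- Depth of `M` with respect to the ideal `J`: sup of lengths of `M`-regular
sequences contained in `J`. -/
noncomputable def rdepth (A : Type*) [CommRing A] (J : Ideal A)
    (M : Type*) [AddCommGroup M] [Module A M] : ℕ∞ :=
  sSup {n : ℕ∞ | ∃ rs : List A, (rs.length : ℕ∞) = n ∧ (∀ x ∈ rs, x ∈ J) ∧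
    RingTheory.Sequence.IsRegular M rs}

/-- A local ring is Cohen-Macaulay if its depth equals its Krull dimension. -/
def IsCMLocal (R : Type*) [CommRing R] [IsLocalRing R] : Prop :=
  (rdepth R (maximalIdeal R) R : WithBot ℕ∞) = ringKrullDim R

/-- A local ring is analytically unramified if its `m`-adic completion is reduced. -/
def AnalyticallyUnramified (R : Type*) [CommRing R] [IsLocalRing R] : Prop :=
  IsReduced (AdicCompletion (maximalIdeal R) R)

/-- An ideal is `m`-primary. -/
def IsMPrimary [CommRing R] [IsLocalRing R] (I : Ideal R) : Prop :=
  I.radical = maximalIdeal R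

/-- `J ⊆ I` is a minimal reduction: generated by `d = dim R` elements and
`I^{n+1} = J I^n` for `n ≫ 0`. -/
def IsMinimalReduction [CommRing R] (d : ℕ) (J I : Ideal R) : Prop :=
  J ≤ I ∧ (∃ s : Fin d → R, J = Ideal.span (Set.range s)) ∧
    ∃ N : ℕ, ∀ n ≥ N, I ^ (n + 1) = J * I ^ n

/-- Normal Hilbert data: `L n = λ(R/ intCl(I^{n+1}))` and for `n ≫ 0` this agrees
with the polynomial whose normalized coefficients are the `e i`. -/
def NormalHilbertData [CommRing R] (d : ℕ) (I : Ideal R) (L : ℕ → ℕ) (e : ℕ → ℤ) : Prop :=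
  (∀ n, mlen R (R ⧸ intCl (I ^ (n + 1))) = (L n : WithBot ℕ∞)) ∧
    ∃ N : ℕ, ∀ n ≥ N, (L n : ℤ) =
      ∑ i ∈ Finset.range (d + 1), (-1 : ℤ) ^ i * e i * ((n + d - i).choose (d - i))

/-- `t` is the Cohen-Macaulay type of the local ring `R` of dimension `d`:
`t = λ((Q : m)/Q)` for every ideal `Q` generated by a maximal regular sequence in `m`. -/
def CMTypeData (R : Type*) [CommRing R] [IsLocalRing R] (d t : ℕ) : Prop :=
  ∀ s : List R, s.length = d → (∀ x ∈ s, x ∈ maximalIdeal R) →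
    RingTheory.Sequence.IsRegular R s →
      mlen R (idealQuot ((Ideal.span {x | x ∈ s}).colon (maximalIdeal R))
        (Ideal.span {x | x ∈ s})) = (t : WithBot ℕ∞)

/-- The quotient module `N/(K ∩ N)` for submodules `N K` of a module. -/
abbrev submoduleQuot {A M : Type*} [CommRing A] [AddCommGroup M] [Module A M]
    (N K : Submodule A M) :=
  N ⧸ (Submodule.comap N.subtype K)


section SallyLocal
open RingTheory.Sequence CategoryTheory Abelian Module
open scoped Pointwise

set_option linter.unusedSectionVars false

universe u

theorem sally_len_le_supportDim {A : Type*} [CommRing A] [IsNoetherianRing A] (rs : List A)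
    {M : Type*} [AddCommGroup M] [Module A M] [Module.Finite A M] (h : IsRegular M rs) :
    (rs.length : WithBot ℕ∞) ≤ supportDim A M := by
  induction rs generalizing M with
  | nil =>
    have := h.nontrivial
    have := supportDim_ne_bot_of_nontrivial A M
    rw [List.length_nil]
    obtain ⟨a, ha⟩ := WithBot.ne_bot_iff_exists.mp this
    rw [← ha]
    exact_mod_cast zero_le
  | cons x xs ih =>
    rw [isRegular_cons_iff] at h
    have h1 := ih h.2
    have h2 := supportDim_quotSMulTop_succ_le_of_notMem_minimalPrimes (R := A) (M := M) (x := x)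
      (fun _ ↦ h.1.notMem_of_mem_minimalPrimes)
    refine le_trans ?_ h2
    rw [List.length_cons]
    push_cast
    gcongr

variable {R : Type u} [CommRing R] [IsLocalRing R] [IsNoetherianRing R]

theorem sally_ann_quot {M : Type*} [AddCommGroup M] [Module R M] (x : R) (P : Ideal R)
    (h : annihilator R (QuotSMulTop x M) ≤ P) : annihilator R M ≤ P ∧ x ∈ P := by
  refine ⟨le_trans ?_ h, h ?_⟩
  · exact LinearMap.annihilator_le_of_surjective (Submodule.mkQ _) (Submodule.mkQ_surjective _)
  · rw [Module.mem_annihilator]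
    intro m
    obtain ⟨m, rfl⟩ := Submodule.mkQ_surjective _ m
    rw [← map_smul, Submodule.mkQ_apply, Submodule.Quotient.mk_eq_zero]
    exact Submodule.smul_mem_pointwise_smul _ _ _ trivial

theorem sally_supportDim_le (xs : List R) (hx : ∀ x ∈ xs, x ∈ maximalIdeal R)
    {M : Type*} [AddCommGroup M] [Module R M] [Module.Finite R M]
    (h : ∀ P : Ideal R, P.IsPrime → annihilator R M ≤ P → (∀ x ∈ xs, x ∈ P) → P = maximalIdeal R) :
    supportDim R M ≤ (xs.length : WithBot ℕ∞) := by
  induction xs generalizing M with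
  | nil =>
    have : Subsingleton (Module.support R M) := by
      constructor
      rintro ⟨p, hp⟩ ⟨q, hq⟩
      have hp' := h p.asIdeal p.2 (by simpa using Module.mem_support_iff_of_finite.mp hp) (by simp)
      have hq' := h q.asIdeal q.2 (by simpa using Module.mem_support_iff_of_finite.mp hq) (by simp)
      ext1; ext1; rw [hp', hq']
    simpa [supportDim] using Order.krullDim_nonpos_of_subsingleton
  | cons x xs ih =>
    simp only [List.mem_cons, forall_eq_or_imp] at hx
    have h1 := supportDim_le_supportDim_quotSMulTop_succ (R := R) (M := M) hx.1
    have h2 := ih hx.2 (M := QuotSMulTop x M) (by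
      intro P hP h1 h2
      obtain ⟨h3, h4⟩ := sally_ann_quot x P h1
      exact h P hP h3 (by simpa using ⟨h4, h2⟩))
    refine h1.trans ?_
    rw [List.length_cons]
    push_cast
    gcongr

theorem sally_unmixed (rs : List R) (hr : ∀ x ∈ rs, x ∈ maximalIdeal R)
    {M : Type*} [AddCommGroup M] [Module R M] [Module.Finite R M] (h : IsRegular M rs)
    (P : Ideal R) (hP : IsAssociatedPrime P M) :
    (rs.length : WithBot ℕ∞) ≤ supportDim R (R ⧸ P) := by
  induction rs generalizing M P with
  | nil =>
    have := hP.isPrime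
    have := supportDim_ne_bot_of_nontrivial R (R ⧸ P)
    rw [List.length_nil]
    obtain ⟨a, ha⟩ := WithBot.ne_bot_iff_exists.mp this
    rw [← ha]
    exact_mod_cast zero_le
  | cons y ys ih =>
    simp only [List.mem_cons, forall_eq_or_imp] at hr
    rw [isRegular_cons_iff] at h
    have hPp := hP.isPrime
    obtain ⟨_, m, hm⟩ := isAssociatedPrime_iff.mp hP
    -- submodule killed by P
    let N : Submodule R M := Submodule.torsionBySet R M P
    have hN : ∀ m : M, m ∈ N ↔ ∀ a ∈ P, a • m = 0 := by
      intro m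
      simp [N, Submodule.mem_torsionBySet_iff]
    have hmN : m ∈ N := by
      rw [hN]
      intro a ha
      rw [hm] at ha
      simpa [LinearMap.mem_ker] using ha
    have hm0 : m ≠ 0 := by
      rintro rfl
      apply hPp.ne_top
      rw [hm]; ext; simp
    have hnot : ¬ N ≤ y • (⊤ : Submodule R M) := by
      intro hle
      have : N ≤ y • N := by
        intro n hn
        obtain ⟨n', -, rfl⟩ := hle hn
        refine Submodule.smul_mem_pointwise_smul _ _ _ ?_
        rw [hN] at hn ⊢
        intro a ha
        apply h.1
        have := hn a ha
        simp only [DistribSMul.toLinearMap_apply] at this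
        change y • a • n' = y • (0 : M)
        rw [smul_zero, smul_comm, this]
      have hbot : N = ⊥ := by
        apply Submodule.eq_bot_of_le_smul_of_le_jacobson_bot (Ideal.span {y}) N
          (IsNoetherian.noetherian N)
        · rwa [Submodule.ideal_span_singleton_smul]
        · rw [Ideal.span_le]
          simpa [IsLocalRing.jacobson_eq_maximalIdeal] using hr.1
      rw [hbot] at hmN
      exact hm0 (by simpa using hmN)
    obtain ⟨n, hn, hny⟩ := SetLike.not_le_iff_exists.mp hnot
    obtain ⟨Q, hQ, hQle⟩ := exists_le_isAssociatedPrime_of_isNoetherianRing R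
      (Submodule.Quotient.mk n : QuotSMulTop y M)
      (by rwa [Ne, Submodule.Quotient.mk_eq_zero])
    have hPQ : P ≤ Q := by
      refine le_trans ?_ hQle
      intro a ha
      simp only [Submodule.mem_colon_singleton, Submodule.mem_bot]
      rw [← Submodule.Quotient.mk_smul, (hN n).mp hn a ha, Submodule.Quotient.mk_zero]
    have hyQ : y ∈ Q := by
      apply hQle
      simp only [Submodule.mem_colon_singleton, Submodule.mem_bot]
      rw [← Submodule.Quotient.mk_smul, Submodule.Quotient.mk_eq_zero]
      exact Submodule.smul_mem_pointwise_smul _ _ _ trivial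
    have hyP : y ∉ P := by
      intro hy
      apply hm0
      apply h.1
      simpa using (hN m).mp hmN y hy
    have key := ih hr.2 h.2 Q hQ
    -- dim R/Q + 1 ≤ dim R/P
    have hreg : IsSMulRegular (R ⧸ P) y := by
      intro a b hab
      obtain ⟨a, rfl⟩ := Ideal.Quotient.mk_surjective a
      obtain ⟨b, rfl⟩ := Ideal.Quotient.mk_surjective b
      have hab' : Ideal.Quotient.mk P (y * a) = Ideal.Quotient.mk P (y * b) := hab
      rw [Ideal.Quotient.eq] at hab' ⊢
      rw [← mul_sub] at hab'
      exact (hPp.mem_or_mem hab').resolve_left hyP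
    have h2 := supportDim_quotSMulTop_succ_le_of_notMem_minimalPrimes (R := R) (M := R ⧸ P) (x := y)
      (fun _ ↦ hreg.notMem_of_mem_minimalPrimes)
    have h3 : supportDim R (R ⧸ Q) ≤ supportDim R (QuotSMulTop y (R ⧸ P)) := by
      refine supportDim_le_of_surjective
        (Submodule.liftQ _ (Submodule.factor hPQ) ?_) ?_
      · rintro _ ⟨a, -, rfl⟩
        obtain ⟨a, rfl⟩ := Submodule.mkQ_surjective _ a
        rw [LinearMap.mem_ker, DistribSMul.toLinearMap_apply, ← map_smul, Submodule.factor_mk,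
          Submodule.mkQ_apply, Submodule.Quotient.mk_eq_zero]
        exact Q.mul_mem_right _ hyQ
      · intro a
        obtain ⟨a, rfl⟩ := Submodule.mkQ_surjective _ a
        exact ⟨Submodule.Quotient.mk (Submodule.Quotient.mk a), rfl⟩
    refine le_trans ?_ h2
    rw [List.length_cons]
    push_cast
    gcongr
    exact key.trans h3

theorem sally_smul_lt (M : Type*) [AddCommGroup M] [Module R M] [Module.Finite R M] [Nontrivial M] :
    maximalIdeal R • (⊤ : Submodule R M) < ⊤ := by
  refine lt_top_iff_ne_top.mpr (Ne.symm ?_)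
  exact Submodule.top_ne_ideal_smul_of_le_jacobson_annihilator (maximalIdeal_le_jacobson _)

theorem sally_exchange (n : ℕ) (M : Type u) [AddCommGroup M] [Module R M] [Module.Finite R M]
    [Nontrivial M]
    (h : ∃ rs : List R, rs.length = n + 1 ∧ (∀ r ∈ rs, r ∈ maximalIdeal R) ∧ IsRegular M rs)
    (x : R) (hx : x ∈ maximalIdeal R) (hreg : IsSMulRegular M x) :
    ∃ rs : List R, rs.length = n ∧ (∀ r ∈ rs, r ∈ maximalIdeal R) ∧
      IsRegular (QuotSMulTop x M) rs := by
  have := nontrivial_quotSMulTop_of_mem_maximalIdeal (L := M) hx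
  have t1 := (ModuleCat.exists_isRegular_tfae (maximalIdeal R) (n + 1) (ModuleCat.of R M)
    (sally_smul_lt M)).out 3 1
  have t2 := (ModuleCat.exists_isRegular_tfae (maximalIdeal R) n
    (ModuleCat.of R (QuotSMulTop x M)) (sally_smul_lt _)).out 3 1
  have h_ext := t1.mp h
  refine t2.mpr ?_
  intro i hi
  have zero1 := AddCommGrpCat.isZero_of_iff_subsingleton.mpr (h_ext i (by omega))
  have zero2 := AddCommGrpCat.isZero_of_iff_subsingleton.mpr (h_ext (i + 1) (by omega))
  exact AddCommGrpCat.subsingleton_of_isZero <| ShortComplex.Exact.isZero_of_both_zeros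
    ((Ext.covariant_sequence_exact₃' _
      (IsSMulRegular.smulShortComplex_shortExact (M := ModuleCat.of R M) hreg)) i (i + 1) rfl)
    (zero1.eq_zero_of_src _) (zero2.eq_zero_of_tgt _)

theorem sally_sop_regular (n : ℕ) (xs : List R) (hlen : xs.length = n)
    (hx : ∀ x ∈ xs, x ∈ maximalIdeal R)
    (M : Type u) [AddCommGroup M] [Module R M] [Module.Finite R M] [Nontrivial M]
    (h : ∃ rs : List R, rs.length = n ∧ (∀ r ∈ rs, r ∈ maximalIdeal R) ∧ IsRegular M rs)
    (hp : ∀ P : Ideal R, P.IsPrime → annihilator R M ≤ P → (∀ x ∈ xs, x ∈ P) →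
      P = maximalIdeal R) :
    IsWeaklyRegular M xs := by
  induction n generalizing M xs with
  | zero =>
    rw [List.length_eq_zero_iff] at hlen
    subst hlen
    exact IsWeaklyRegular.nil _ _
  | succ n ih =>
    match xs with
    | [] => simp at hlen
    | x :: xs =>
      simp only [List.length_cons, Nat.add_right_cancel_iff] at hlen
      simp only [List.mem_cons, forall_eq_or_imp] at hx
      have hreg : IsSMulRegular M x := by
        by_contra hcon
        have : x ∈ ({ r : R | IsSMulRegular M r }ᶜ : Set R) := hcon
        rw [← biUnion_associatedPrimes_eq_compl_regular R M] at this
        simp only [Set.mem_iUnion] at this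
        obtain ⟨P, hP, hxP⟩ := this
        obtain ⟨rs, hl, hr, hrr⟩ := h
        have h1 := sally_unmixed rs hr hrr P hP
        have h2 := sally_supportDim_le xs hx.2 (M := R ⧸ P) (by
          intro Q hQ hle hxs
          rw [Ideal.annihilator_quotient] at hle
          refine hp Q hQ (le_trans (Submodule.annihilator_top (R := R) (M := M) ▸ hP.annihilator_le) hle) ?_
          simpa using ⟨hle hxP, hxs⟩)
        have h3 := h1.trans h2
        rw [hl, hlen] at h3
        have : n + 1 ≤ n := by exact_mod_cast h3
        omega
      have := nontrivial_quotSMulTop_of_mem_maximalIdeal (L := M) hx.1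
      refine IsWeaklyRegular.cons hreg (ih xs hlen hx.2 (QuotSMulTop x M)
        (sally_exchange n M h x hx.1 hreg) ?_)
      intro P hP h1 h2
      obtain ⟨h3, h4⟩ := sally_ann_quot x P h1
      exact hp P hP h3 (by simpa using ⟨h4, h2⟩)

end SallyLocal
section SallyIdeals
open RingTheory.Sequence

theorem sally_ofList_take {S : Type*} [CommRing S] {d : ℕ} (s : Fin d → S) (k : ℕ) :
    Ideal.ofList ((List.ofFn s).take k) = Ideal.span (s '' {i | (i : ℕ) < k}) := by
  unfold Ideal.ofList
  congr 1
  ext x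
  simp only [Set.mem_ofPred_eq, Set.mem_image, List.mem_take_iff_getElem, List.getElem_ofFn]
  constructor
  · rintro ⟨j, hj, rfl⟩
    simp only [List.length_ofFn] at hj
    exact ⟨⟨j, by omega⟩, by simpa using by omega, rfl⟩
  · rintro ⟨i, hi, rfl⟩
    exact ⟨i, by simp only [List.length_ofFn]; omega, rfl⟩

theorem sally_weaklyRegular_iff {S : Type*} [CommRing S] {d : ℕ} (s : Fin d → S) :
    IsWeaklyRegular S (List.ofFn s) ↔ ∀ k : Fin d, ∀ c : S,
      s k * c ∈ Ideal.span (s '' {i | (i : ℕ) < k}) → c ∈ Ideal.span (s '' {i | (i : ℕ) < k}) := by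
  rw [isWeaklyRegular_iff]
  simp only [List.length_ofFn, List.getElem_ofFn, isSMulRegular_quotient_iff_mem_of_smul_mem,
    sally_ofList_take, smul_eq_mul, Ideal.mul_top]
  exact ⟨fun h k ↦ h k k.2, fun h i hi ↦ h ⟨i, hi⟩⟩

variable {R : Type*} [CommRing R]

theorem sally_span_succ {d : ℕ} (s : Fin d → R) (k : Fin d) :
    Ideal.span (s '' {i | (i : ℕ) < (k : ℕ) + 1}) =
      Ideal.span (s '' {i | (i : ℕ) < k}) ⊔ Ideal.span {s k} := by
  rw [← Ideal.span_union]
  congr 1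
  ext x
  simp only [Set.mem_image, Set.mem_ofPred_eq, Set.mem_union, Set.mem_singleton_iff]
  constructor
  · rintro ⟨i, hi, rfl⟩
    rcases Nat.lt_succ_iff_lt_or_eq.mp hi with h | h
    · exact Or.inl ⟨i, h, rfl⟩
    · right; congr; exact Fin.ext h
  · rintro (⟨i, hi, rfl⟩ | rfl)
    · exact ⟨i, by omega, rfl⟩
    · exact ⟨k, by omega, rfl⟩

/-- Valabrega-Valla. -/
theorem sally_VV {d : ℕ} (s : Fin d → R) (F : ℕ → Ideal R) (hF0 : F 0 = ⊤)
    (hmul : ∀ i n b, b ∈ F n → s i * b ∈ F (n + 1))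
    (hred : ∀ n, F (n + 2) ≤ Ideal.span (Set.range s) * F (n + 1))
    (hreg : ∀ k : Fin d, ∀ c : R,
      s k * c ∈ Ideal.span (s '' {i | (i : ℕ) < k}) → c ∈ Ideal.span (s '' {i | (i : ℕ) < k}))
    (j : ℕ) (hj : j ≤ d) (n : ℕ) :
    Ideal.span (s '' {i | (i : ℕ) < d - j}) ⊓ F (n + 1) ≤
      Ideal.span (s '' {i | (i : ℕ) < d - j}) * F n := by
  induction j generalizing n with
  | zero =>
    have : s '' {i | (i : ℕ) < d - 0} = Set.range s := by
      rw [← Set.image_univ]; congr; ext i; simp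
    rw [this]
    cases n with
    | zero => rw [hF0, Ideal.mul_top]; exact inf_le_left
    | succ n => exact inf_le_right.trans (hred n)
  | succ j ih =>
    have ih := ih (by omega)
    obtain ⟨k, hk⟩ : ∃ k : Fin d, (k : ℕ) = d - (j + 1) := ⟨⟨d - (j + 1), by omega⟩, rfl⟩
    have hk' : d - j = (k : ℕ) + 1 := by omega
    rw [← hk]
    rw [hk'] at ih
    induction n with
    | zero => rw [hF0, Ideal.mul_top]; exact inf_le_left
    | succ n ihn =>
      rintro y ⟨hy1, hy2⟩
      have h1 : y ∈ Ideal.span (s '' {i | (i : ℕ) < (k : ℕ) + 1}) := by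
        rw [sally_span_succ]; exact Ideal.mem_sup_left hy1
      have h2 := ih (n + 1) ⟨h1, hy2⟩
      rw [sally_span_succ, Ideal.sup_mul] at h2
      obtain ⟨u, hu, v, hv, rfl⟩ := Submodule.mem_sup.mp h2
      obtain ⟨c, hc, rfl⟩ := Ideal.mem_span_singleton_mul.mp hv
      have hc1 : s k * c ∈ Ideal.span (s '' {i | (i : ℕ) < k}) :=
        (Ideal.add_mem_iff_right _ (Ideal.mul_le_left hu)).mp hy1
      have hc2 := ihn ⟨hreg k c hc1, hc⟩
      refine Ideal.add_mem _ hu ?_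
      have : Ideal.span {s k} * (Ideal.span (s '' {i | (i : ℕ) < k}) * F n) ≤
          Ideal.span (s '' {i | (i : ℕ) < k}) * F (n + 1) := by
        rw [mul_left_comm]
        refine Ideal.mul_mono_right ?_
        intro z hz
        obtain ⟨w, hw, rfl⟩ := Ideal.mem_span_singleton_mul.mp hz
        exact hmul _ _ _ hw
      exact this (Ideal.mul_mem_mul (Ideal.mem_span_singleton_self _) hc2)

/-- The graded pieces of the ideal generated by the initial forms. -/
def sallyH (Q : Ideal R) (F : ℕ → Ideal R) : ℕ → Ideal R
  | 0 => F 1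
  | n + 1 => Q * F n ⊔ F (n + 2)

theorem sally_coeff_step {d : ℕ} (s : Fin d → R) (F : ℕ → Ideal R) (hF0 : F 0 = ⊤)
    (hs1 : ∀ i, s i ∈ F 1)
    (hmul : ∀ i n b, b ∈ F n → s i * b ∈ F (n + 1))
    (hred : ∀ n, F (n + 2) ≤ Ideal.span (Set.range s) * F (n + 1))
    (hreg : ∀ k : Fin d, ∀ c : R,
      s k * c ∈ Ideal.span (s '' {i | (i : ℕ) < k}) → c ∈ Ideal.span (s '' {i | (i : ℕ) < k}))
    (hanti : ∀ n, F (n + 1) ≤ F n)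
    (k : Fin d) (n : ℕ) (a : R) (ha : a ∈ F n)
    (h : s k * a ∈ sallyH (Ideal.span (s '' {i | (i : ℕ) < k})) F (n + 1)) :
    a ∈ sallyH (Ideal.span (s '' {i | (i : ℕ) < k})) F n := by
  obtain ⟨u, hu, v, hv, huv⟩ := Submodule.mem_sup.mp h
  have hVV := sally_VV s F hF0 hmul hred hreg (d - (k + 1)) (by omega)
  rw [show d - (d - ((k : ℕ) + 1)) = k + 1 by omega] at hVV
  have hVV' := sally_VV s F hF0 hmul hred hreg (d - k) (by omega)
  rw [show d - (d - (k : ℕ)) = k by omega] at hVV'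
  have hv1 : v ∈ Ideal.span (s '' {i | (i : ℕ) < (k : ℕ) + 1}) := by
    rw [sally_span_succ, show v = - u + s k * a by rw [← huv]; ring]
    exact Ideal.add_mem _ (Ideal.mem_sup_left (neg_mem (Ideal.mul_le_left hu)))
      (Ideal.mem_sup_right (Ideal.mul_mem_right _ _ (Ideal.mem_span_singleton_self _)))
  have h2 := hVV (n + 1) ⟨hv1, hv⟩
  rw [sally_span_succ, Ideal.sup_mul] at h2
  obtain ⟨w, hw, z, hz, rfl⟩ := Submodule.mem_sup.mp h2
  obtain ⟨b, hb, rfl⟩ := Ideal.mem_span_singleton_mul.mp hz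
  have h3 : s k * (a - b) ∈ Ideal.span (s '' {i | (i : ℕ) < k}) := by
    rw [show s k * (a - b) = u + w by rw [mul_sub, ← huv]; ring]
    exact Ideal.add_mem _ (Ideal.mul_le_left hu) (Ideal.mul_le_left hw)
  have h4 := hreg k _ h3
  have h5 : a = (a - b) + b := by ring
  cases n with
  | zero =>
    change a ∈ F 1
    rw [h5]
    refine Ideal.add_mem _ ?_ hb
    refine (Ideal.span_le.mpr ?_) h4
    rintro _ ⟨i, -, rfl⟩
    exact hs1 i
  | succ n =>
    change a ∈ _ ⊔ _
    rw [h5]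
    refine Ideal.add_mem _ (Ideal.mem_sup_left ?_) (Ideal.mem_sup_right hb)
    exact hVV' n ⟨h4, sub_mem ha (hanti _ hb)⟩

end SallyIdeals

section SallyRees
open RingTheory.Sequence

variable {R : Type*} [CommRing R]

/-- The `n`-th coefficient ideal of a submodule of a subalgebra of `R[X]`. -/
noncomputable def sallyC (A : Subalgebra R (Polynomial R)) (T : Submodule R A) (n : ℕ) : Ideal R :=
  (T.map A.val.toLinearMap).comap (Polynomial.monomial n)

theorem sally_mem_C {A : Subalgebra R (Polynomial R)} {T : Submodule R A} {n : ℕ} {a : R} :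
    a ∈ sallyC A T n ↔ ∃ p ∈ T, (p : Polynomial R) = Polynomial.monomial n a := by
  simp only [sallyC, Submodule.mem_comap, Submodule.mem_map]
  rfl

theorem sally_mem_of_coeff {A : Subalgebra R (Polynomial R)} {T : Submodule R A} (p : A)
    (h : ∀ n, (p : Polynomial R).coeff n ∈ sallyC A T n) : p ∈ T := by
  have : (p : Polynomial R) ∈ T.map A.val.toLinearMap := by
    rw [(p : Polynomial R).as_sum_range]
    exact Submodule.sum_mem _ fun n _ ↦ h n
  obtain ⟨q, hq, hqp⟩ := this
  have : q = p := Subtype.ext hqp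
  exact this ▸ hq

variable {F : ℕ → Ideal R} {A : Subalgebra R (Polynomial R)}

theorem sally_monomial_mem
    (hA : ∀ p : Polynomial R, p ∈ A ↔ ∀ n, p.coeff n ∈ F n)
    {n : ℕ} {a : R} (ha : a ∈ F n) : Polynomial.monomial n a ∈ A := by
  rw [hA]
  intro m
  rw [Polynomial.coeff_monomial]
  split_ifs with h
  · exact h ▸ ha
  · exact zero_mem _

theorem sally_F_mul
    (hA : ∀ p : Polynomial R, p ∈ A ↔ ∀ n, p.coeff n ∈ F n)
    {m n : ℕ} {a b : R} (ha : a ∈ F m) (hb : b ∈ F n) : a * b ∈ F (m + n) := by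
  have := A.mul_mem (sally_monomial_mem hA ha) (sally_monomial_mem hA hb)
  rw [Polynomial.monomial_mul_monomial, hA] at this
  simpa using this (m + n)

theorem sally_mem_L
    (hA : ∀ p : Polynomial R, p ∈ A ↔ ∀ n, p.coeff n ∈ F n)
    {d : ℕ} (s : Fin d → R) (hanti : ∀ n, F (n + 1) ≤ F n)
    (g : Fin d → A) (hg : ∀ i, (g i : Polynomial R) = Polynomial.monomial 1 (s i))
    (K : Ideal A) (hK : ∀ p : A, p ∈ K ↔ ∀ n, (p : Polynomial R).coeff n ∈ F (n + 1))
    (S : Set (Fin d)) (p : A) :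
    p ∈ Ideal.span (g '' S) ⊔ K ↔
      ∀ n, (p : Polynomial R).coeff n ∈ sallyH (Ideal.span (s '' S)) F n := by
  have hFH : ∀ n, F (n + 1) ≤ sallyH (Ideal.span (s '' S)) F n := by
    intro n
    cases n with
    | zero => exact le_rfl
    | succ n => exact le_sup_right
  constructor
  · intro hp n
    obtain ⟨u, hu, v, hv, rfl⟩ := Submodule.mem_sup.mp hp
    have hv' := hFH n ((hK v).mp hv n)
    rw [show ((u + v : A) : Polynomial R) = (u : Polynomial R) + v from rfl, Polynomial.coeff_add]
    refine Ideal.add_mem _ ?_ hv'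
    clear hv' hv hp
    have key : ∀ a : A, ∀ n, ((a * u : A) : Polynomial R).coeff n ∈
        sallyH (Ideal.span (s '' S)) F n := by
      clear n
      induction hu using Submodule.span_induction with
      | mem x hx =>
        obtain ⟨i, hi, rfl⟩ := hx
        intro a n
        rw [Subalgebra.coe_mul, hg]
        cases n with
        | zero => simp [Polynomial.mul_coeff_zero, Polynomial.coeff_monomial]
        | succ n =>
          rw [Polynomial.coeff_mul_monomial, mul_comm]
          exact Ideal.mem_sup_left (Ideal.mul_mem_mul
            (Ideal.subset_span (Set.mem_image_of_mem _ hi)) ((hA _).mp a.2 n))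
      | zero => simp
      | add x y _ _ hx hy =>
        intro a n
        rw [mul_add, Subalgebra.coe_add, Polynomial.coeff_add]
        exact Ideal.add_mem _ (hx a n) (hy a n)
      | smul b x _ hx =>
        intro a n
        rw [smul_eq_mul, ← mul_assoc]
        exact hx (a * b) n
    simpa using key 1 n
  · intro h
    have := sally_mem_of_coeff (T := (Ideal.span (g '' S) ⊔ K).restrictScalars R) p
    refine this fun n ↦ ?_
    have hKC : ∀ n, F (n + 1) ≤ sallyC A ((Ideal.span (g '' S) ⊔ K).restrictScalars R) n := by
      intro n a ha
      rw [sally_mem_C]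
      refine ⟨⟨_, sally_monomial_mem hA (hanti n ha)⟩, ?_, rfl⟩
      refine Ideal.mem_sup_right ((hK _).mpr fun m ↦ ?_)
      rw [Polynomial.coeff_monomial]
      split_ifs with h
      · exact h ▸ ha
      · exact zero_mem _
    suffices hh : sallyH (Ideal.span (s '' S)) F n ≤
        sallyC A ((Ideal.span (g '' S) ⊔ K).restrictScalars R) n from hh (h n)
    cases n with
    | zero => exact hKC 0
    | succ n =>
      refine sup_le ?_ (hKC (n + 1))
      rw [Ideal.mul_le]
      intro r hr b hb
      have : Ideal.span (s '' S) ≤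
          (sallyC A ((Ideal.span (g '' S) ⊔ K).restrictScalars R) (n + 1)).colon {b} := by
        rw [Ideal.span_le]
        rintro _ ⟨i, hi, rfl⟩
        rw [SetLike.mem_coe, Submodule.mem_colon_singleton, smul_eq_mul, sally_mem_C]
        refine ⟨g i * ⟨_, sally_monomial_mem hA hb⟩, ?_, ?_⟩
        · exact Ideal.mem_sup_left (Ideal.mul_mem_right _ _
            (Ideal.subset_span (Set.mem_image_of_mem _ hi)))
        · rw [Subalgebra.coe_mul, hg, Polynomial.monomial_mul_monomial, add_comm]
      exact Submodule.mem_colon_singleton.mp (this hr)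

end SallyRees
section SallyDim
open RingTheory.Sequence

theorem sally_dim_le_of_integral {B G : Type*} [CommRing B] [CommRing G] (φ : B →+* G)
    (h : φ.IsIntegral) : ringKrullDim G ≤ ringKrullDim B := by
  algebraize [φ]
  refine Order.krullDim_le_of_strictMono (PrimeSpectrum.comap φ) ?_
  intro p q hpq
  have := p.2
  exact Ideal.IsIntegral.comap_lt_comap (R := B) (A := G) (I := p.asIdeal) (J := q.asIdeal) hpq

theorem sally_noeth_of_finite {B G : Type*} [CommRing B] [CommRing G] [IsNoetherianRing B]
    (φ : B →+* G) (h : φ.Finite) : IsNoetherianRing G := by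
  algebraize [φ]
  exact IsNoetherianRing.of_finite B G

variable {R : Type*} [CommRing R] [IsNoetherianRing R]

theorem sally_finite {d : ℕ} (s : Fin d → R) {F : ℕ → Ideal R} {A : Subalgebra R (Polynomial R)}
    (hA : ∀ p : Polynomial R, p ∈ A ↔ ∀ n, p.coeff n ∈ F n)
    (hred : ∀ n, F (n + 2) ≤ Ideal.span (Set.range s) * F (n + 1))
    (g : Fin d → A) (hg : ∀ i, (g i : Polynomial R) = Polynomial.monomial 1 (s i))
    (K : Ideal A) :
    RingHom.Finite (A := MvPolynomial (Fin d) R) (B := A ⧸ K)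
      (MvPolynomial.aeval (fun i ↦ Ideal.Quotient.mk K (g i)) :
        MvPolynomial (Fin d) R →ₐ[R] A ⧸ K).toRingHom := by
  set φ : MvPolynomial (Fin d) R →ₐ[R] A ⧸ K :=
    MvPolynomial.aeval (fun i ↦ Ideal.Quotient.mk K (g i)) with hφ
  let _ : Algebra (MvPolynomial (Fin d) R) (A ⧸ K) := 
    RingHom.toAlgebra (R := MvPolynomial (Fin d) R) (S := A ⧸ K) φ.toRingHom
  have hsm : ∀ (b : MvPolynomial (Fin d) R) (x : A ⧸ K), b • x = φ b * x := fun b x ↦ rfl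
  have : IsScalarTower R (MvPolynomial (Fin d) R) (A ⧸ K) :=
    IsScalarTower.of_algebraMap_eq fun r ↦ (φ.commutes r).symm
  change Module.Finite (MvPolynomial (Fin d) R) (A ⧸ K)
  obtain ⟨t, ht⟩ := IsNoetherian.noetherian (F 1)
  have htF : ∀ f ∈ t, f ∈ F 1 := fun f hf ↦ ht ▸ Ideal.subset_span hf
  let w : t → A ⧸ K := fun f ↦ Ideal.Quotient.mk K ⟨_, sally_monomial_mem hA (htF f f.2)⟩
  let N : Submodule (MvPolynomial (Fin d) R) (A ⧸ K) :=
    Submodule.span _ (insert 1 (Set.range w))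
  have hN : N.FG := Submodule.fg_span ((Set.finite_range w).insert 1)
  suffices h : N = ⊤ from ⟨h ▸ hN⟩
  let T : Submodule R A := (N.restrictScalars R).comap (Ideal.Quotient.mkₐ R K).toLinearMap
  have hT : ∀ p : A, p ∈ T ↔ Ideal.Quotient.mk K p ∈ N := fun p ↦ Iff.rfl
  have key : ∀ n, F n ≤ sallyC A T n := by
    have h0 : F 0 ≤ sallyC A T 0 := by
      intro a ha
      rw [sally_mem_C]
      refine ⟨algebraMap R A a, ?_, ?_⟩
      · rw [hT]
        have h1 : (1 : A ⧸ K) ∈ N := Submodule.subset_span (Set.mem_insert _ _)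
        have h2 := N.smul_mem (algebraMap R _ a) h1
        rw [hsm, mul_one, φ.commutes] at h2
        exact h2
      · rfl
    intro n
    induction n with
    | zero => exact h0
    | succ n ih =>
      cases n with
      | zero =>
        rw [← ht, Ideal.span_le]
        intro f hf
        rw [SetLike.mem_coe, sally_mem_C]
        exact ⟨_, (hT _).mpr (Submodule.subset_span (Set.mem_insert_of_mem _ ⟨⟨f, hf⟩, rfl⟩)), rfl⟩
      | succ n =>
        refine (hred n).trans (Ideal.mul_le.mpr ?_)
        intro r hr b hb
        have : Ideal.span (Set.range s) ≤ (sallyC A T (n + 2)).colon {b} := by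
          rw [Ideal.span_le]
          rintro _ ⟨i, rfl⟩
          rw [SetLike.mem_coe, Submodule.mem_colon_singleton, smul_eq_mul, sally_mem_C]
          obtain ⟨p, hp, hpb⟩ := sally_mem_C.mp (ih hb)
          refine ⟨g i * p, ?_, ?_⟩
          · rw [hT] at hp ⊢
            have h2 := N.smul_mem (MvPolynomial.X i) hp
            rw [hsm, hφ, MvPolynomial.aeval_X, ← map_mul] at h2
            exact h2
          · rw [Subalgebra.coe_mul, hg, hpb, Polynomial.monomial_mul_monomial,
              show 1 + (n + 1) = n + 2 by omega]
        exact Submodule.mem_colon_singleton.mp (this hr)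
  rw [eq_top_iff]
  intro x _
  obtain ⟨p, rfl⟩ := Ideal.Quotient.mk_surjective x
  exact (hT p).mp (sally_mem_of_coeff p fun n ↦ key n ((hA _).mp p.2 n))

theorem sally_dim_le {d : ℕ} (s : Fin d → R) {F : ℕ → Ideal R} {A : Subalgebra R (Polynomial R)}
    (hA : ∀ p : Polynomial R, p ∈ A ↔ ∀ n, p.coeff n ∈ F n)
    (hred : ∀ n, F (n + 2) ≤ Ideal.span (Set.range s) * F (n + 1))
    (g : Fin d → A) (hg : ∀ i, (g i : Polynomial R) = Polynomial.monomial 1 (s i))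
    (K : Ideal A) (hK : ∀ p : A, p ∈ K ↔ ∀ n, (p : Polynomial R).coeff n ∈ F (n + 1))
    (m : Ideal R) (hm : ∀ P : Ideal R, P.IsPrime → F 1 ≤ P → P = m) :
    IsNoetherianRing (A ⧸ K) ∧ ringKrullDim (A ⧸ K) ≤ d := by
  have hfin := sally_finite s hA hred g hg K
  set φ : MvPolynomial (Fin d) R →ₐ[R] A ⧸ K :=
    MvPolynomial.aeval (fun i ↦ Ideal.Quotient.mk K (g i)) with hφ
  let ψ0 : R ⧸ F 1 →+* A ⧸ K := Ideal.Quotient.lift (F 1) (algebraMap R (A ⧸ K)) (by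
    intro a ha
    change Ideal.Quotient.mk K (algebraMap R A a) = 0
    rw [Ideal.Quotient.eq_zero_iff_mem, hK]
    intro n
    change (Polynomial.C a).coeff n ∈ _
    rw [Polynomial.coeff_C]
    split_ifs with h
    · rw [h]; exact ha
    · exact zero_mem _)
  let ψ : MvPolynomial (Fin d) (R ⧸ F 1) →+* A ⧸ K :=
    MvPolynomial.eval₂Hom ψ0 (fun i ↦ Ideal.Quotient.mk K (g i))
  have hcomp : ψ.comp (MvPolynomial.map (Ideal.Quotient.mk (F 1))) =
      φ.toRingHom := by
    ext r
    · simp [ψ, ψ0, hφ]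
    · simp [ψ, hφ]
  have hψ : RingHom.Finite (A := MvPolynomial (Fin d) (R ⧸ F 1)) (B := A ⧸ K) ψ := by
    rw [← hcomp] at hfin
    exact RingHom.Finite.of_comp_finite hfin
  constructor
  · exact sally_noeth_of_finite (B := MvPolynomial (Fin d) (R ⧸ F 1)) (G := A ⧸ K) ψ hψ
  · refine (sally_dim_le_of_integral (B := MvPolynomial (Fin d) (R ⧸ F 1)) (G := A ⧸ K) ψ
      (RingHom.Finite.to_isIntegral hψ)).trans ?_
    rw [MvPolynomial.ringKrullDim_of_isNoetherianRing, Nat.card_fin]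
    have : ringKrullDim (R ⧸ F 1) ≤ 0 := by
      rw [ringKrullDim_quotient]
      have : Subsingleton (PrimeSpectrum.zeroLocus (R := R) (F 1)) := by
        constructor
        rintro ⟨p, hp⟩ ⟨q, hq⟩
        ext1; ext1
        rw [hm p.asIdeal p.2 hp, hm q.asIdeal q.2 hq]
      exact Order.krullDim_nonpos_of_subsingleton
    calc ringKrullDim (R ⧸ F 1) + (d : WithBot ℕ∞) ≤ 0 + d := by gcongr
      _ = d := zero_add _

end SallyDim

section SallyIntCl
variable {R : Type*} [CommRing R]

theorem sally_le_intCl (I : Ideal R) : I ≤ intCl I := by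
  intro x hx
  refine Ideal.subset_span ⟨1, one_pos, fun _ ↦ -x, ?_, ?_⟩
  · simpa using hx
  · simp

theorem sally_intCl_mono {I J : Ideal R} (h : I ≤ J) : intCl I ≤ intCl J := by
  refine Ideal.span_mono ?_
  rintro x ⟨n, hn, a, ha, hx⟩
  exact ⟨n, hn, a, fun i hi ↦ Ideal.pow_right_mono h i (ha i hi), hx⟩

theorem sally_intCl_le {I P : Ideal R} [P.IsPrime] (h : I ≤ P) : intCl I ≤ P := by
  refine Ideal.span_le.mpr ?_
  rintro x ⟨n, hn, a, ha, hx⟩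
  refine Ideal.IsPrime.mem_of_pow_mem ‹_› n ?_
  rw [eq_neg_of_add_eq_zero_left hx]
  refine neg_mem (Ideal.sum_mem _ fun i hi ↦ Ideal.mul_mem_right _ _ (h ?_))
  have := (Finset.mem_Icc.mp hi).1
  exact Ideal.pow_le_self (by omega) (ha i hi)

end SallyIntCl
theorem sally_zero_implies_CM_agr
    (R : Type*) [CommRing R] [IsLocalRing R] [IsNoetherianRing R]
    (d : ℕ) (hd : 0 < d) (hdim : ringKrullDim R = d)
    (hCM : IsCMLocal R) (hAU : AnalyticallyUnramified R)
    (hres : Infinite (ResidueField R))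
    (I J : Ideal R) (hI : IsMPrimary I) (hJ : IsMinimalReduction d J I)
    -- the Sally module of the normal filtration vanishes
    (hS : ∀ n, 1 ≤ n → intCl (I ^ (n + 1)) ≤ J ^ n * intCl I)
    -- the Rees algebra of the normal filtration
    (A : Subalgebra R (Polynomial R))
    (hA : ∀ p : Polynomial R, p ∈ A ↔ ∀ n, p.coeff n ∈ intCl (I ^ n))
    -- the ideal cutting out the associated graded ring of the normal filtration
    (K : Ideal A)
    (hK : ∀ p : A, p ∈ K ↔ ∀ n, (p : Polynomial R).coeff n ∈ intCl (I ^ (n + 1)))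
    -- the maximal homogeneous ideal
    (MG : Ideal A)
    (hMG : ∀ p : A, p ∈ MG ↔ (p : Polynomial R).coeff 0 ∈ maximalIdeal R) :
    -- the associated graded ring `Ḡ = A ⧸ K` of the normal filtration is Cohen-Macaulay
    (rdepth (A ⧸ K) (MG.map (Ideal.Quotient.mk K)) (A ⧸ K) : WithBot ℕ∞) =
      ringKrullDim (A ⧸ K) := by
  obtain ⟨hJI, ⟨s, rfl⟩, N, hN⟩ := hJ
  have hIm : I ≤ maximalIdeal R := by
    rw [← hI]; exact Ideal.le_radical
  have hPm : ∀ P : Ideal R, P.IsPrime → I ≤ P → P = maximalIdeal R := by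
    intro P hP h
    refine le_antisymm (le_maximalIdeal hP.ne_top) ?_
    rw [← hI]
    exact (hP.radical_le_iff).mpr h
  -- the filtration
  obtain ⟨F, hF⟩ : ∃ F : ℕ → Ideal R, ∀ n, intCl (I ^ n) = F n := ⟨_, fun _ ↦ rfl⟩
  have hF0 : F 0 = ⊤ := by
    rw [← hF, pow_zero, Ideal.one_eq_top, eq_top_iff]
    exact sally_le_intCl _
  have hF1 : F 1 = intCl I := by rw [← hF, pow_one]
  have hanti : ∀ n, F (n + 1) ≤ F n := by
    intro n
    rw [← hF, ← hF]
    exact sally_intCl_mono (Ideal.pow_le_pow_right (Nat.le_succ n))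
  have hIF : I ≤ F 1 := hF1 ▸ sally_le_intCl I
  have hF1m : F 1 ≤ maximalIdeal R := hF1 ▸ sally_intCl_le hIm
  simp only [hF] at hA hK hS
  rw [← hF1] at hS
  have hs1 : ∀ i, s i ∈ F 1 := fun i ↦ hIF (hJI (Ideal.subset_span ⟨i, rfl⟩))
  have hmul : ∀ i n b, b ∈ F n → s i * b ∈ F (n + 1) := by
    intro i n b hb
    rw [add_comm]
    exact sally_F_mul hA (hs1 i) hb
  have hJF : ∀ n, Ideal.span (Set.range s) ^ n * F 1 ≤ F (n + 1) := by
    intro n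
    induction n with
    | zero => simp
    | succ n ih =>
      rw [pow_succ', mul_assoc]
      refine (Ideal.mul_mono_right ih).trans (Ideal.mul_le.mpr ?_)
      intro r hr b hb
      rw [add_comm]
      exact sally_F_mul hA (hIF (hJI hr)) hb
  have hred : ∀ n, F (n + 2) ≤ Ideal.span (Set.range s) * F (n + 1) := by
    intro n
    refine (hS (n + 1) (by omega)).trans ?_
    rw [pow_succ', mul_assoc]
    exact Ideal.mul_mono_right (hJF n)
  -- `s` is a regular sequence
  have hsreg : RingTheory.Sequence.IsWeaklyRegular R (List.ofFn s) := by
    refine sally_sop_regular d (List.ofFn s) (by simp) ?_ R ?_ ?_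
    · intro x hx
      obtain ⟨i, rfl⟩ := List.mem_ofFn.mp hx
      exact hF1m (hs1 i)
    · unfold IsCMLocal at hCM
      rw [hdim] at hCM
      have hCM' : rdepth R (maximalIdeal R) R = d := by exact_mod_cast hCM
      unfold rdepth at hCM'
      have hlt : ((d - 1 : ℕ) : ℕ∞) < sSup {n : ℕ∞ | ∃ rs : List R, (rs.length : ℕ∞) = n ∧
          (∀ x ∈ rs, x ∈ maximalIdeal R) ∧ RingTheory.Sequence.IsRegular R rs} := by
        rw [hCM']
        exact_mod_cast (by omega : d - 1 < d)
      obtain ⟨n, ⟨rs, rfl, hr, hreg⟩, hn⟩ := lt_sSup_iff.mp hlt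
      have hn' : d - 1 < rs.length := by exact_mod_cast hn
      refine ⟨rs.take d, by simp; omega, fun r h ↦ hr r (List.mem_of_mem_take h), ?_⟩
      refine RingTheory.Sequence.IsRegular.of_isWeaklyRegular_of_mem_maximalIdeal R
        (fun r h ↦ hr r (List.mem_of_mem_take h)) ?_
      have h1 := hreg.toIsWeaklyRegular
      rw [← List.take_append_drop d rs, RingTheory.Sequence.isWeaklyRegular_append_iff] at h1
      exact h1.1
    · intro P hP _ h
      refine hPm P hP ?_
      have hJP : Ideal.span (Set.range s) ≤ P := by
        rw [Ideal.span_le]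
        rintro _ ⟨i, rfl⟩
        exact h _ (List.mem_ofFn.mpr ⟨i, rfl⟩)
      have : I ^ (N + 1) ≤ P := by
        rw [hN N le_rfl]
        exact Ideal.mul_le_left.trans hJP
      exact hP.le_of_pow_le this
  rw [sally_weaklyRegular_iff] at hsreg
  -- initial forms
  obtain ⟨g, hg⟩ : ∃ g : Fin d → A, ∀ i, (g i : Polynomial R) = Polynomial.monomial 1 (s i) :=
    ⟨fun i ↦ ⟨_, sally_monomial_mem hA (hs1 i)⟩, fun i ↦ rfl⟩
  have hmemL : ∀ (S : Set (Fin d)) (p : A),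
      Ideal.Quotient.mk K p ∈ Ideal.span ((fun i ↦ Ideal.Quotient.mk K (g i)) '' S) ↔
      ∀ n, (p : Polynomial R).coeff n ∈ sallyH (Ideal.span (s '' S)) F n := by
    intro S p
    rw [← sally_mem_L hA s hanti g hg K hK S p]
    rw [show (fun i ↦ Ideal.Quotient.mk K (g i)) '' S = (Ideal.Quotient.mk K) '' (g '' S) from
      (Set.image_image _ _ _).symm, ← Ideal.map_span, Ideal.mem_quotient_iff_mem_sup]
  obtain ⟨hnoeth, hdimle⟩ := sally_dim_le s hA hred g hg K hK (maximalIdeal R)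
    (fun P hP h ↦ hPm P hP (hIF.trans h))
  have hGreg : RingTheory.Sequence.IsRegular (A ⧸ K)
      (List.ofFn fun i ↦ Ideal.Quotient.mk K (g i)) := by
    refine ⟨(sally_weaklyRegular_iff _).mpr ?_, ?_⟩
    · intro k c hc
      obtain ⟨p, rfl⟩ := Ideal.Quotient.mk_surjective c
      rw [← map_mul, hmemL] at hc
      rw [hmemL]
      intro n
      refine sally_coeff_step s F hF0 hs1 hmul hred hsreg hanti k n _ ((hA _).mp p.2 n) ?_
      have := hc (n + 1)
      rw [Subalgebra.coe_mul, hg, Polynomial.coeff_monomial_mul] at this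
      exact this
    · intro htop
      have h1 : (1 : A ⧸ K) ∈ Ideal.span ((fun i ↦ Ideal.Quotient.mk K (g i)) ''
          {i | (i : ℕ) < d}) := by
        rw [← sally_ofList_take (fun i ↦ Ideal.Quotient.mk K (g i)) d,
          List.take_of_length_le (by simp)]
        have : (1 : A ⧸ K) ∈ (⊤ : Submodule (A ⧸ K) (A ⧸ K)) := trivial
        rw [htop, smul_eq_mul, Ideal.mul_top] at this
        exact this
      have h2 := (hmemL {i | (i : ℕ) < d} 1).mp (by rw [map_one]; exact h1) 0
      have h3 : (1 : R) ∈ F 1 := by simpa [sallyH] using h2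
      exact (Ideal.ne_top_iff_one _).mp (maximalIdeal.isMaximal R).ne_top (hF1m h3)
  apply le_antisymm
  · have hle : ∀ rs : List (A ⧸ K), RingTheory.Sequence.IsRegular (A ⧸ K) rs →
        (rs.length : WithBot ℕ∞) ≤ ringKrullDim (A ⧸ K) := by
      intro rs h
      rw [← Module.supportDim_self_eq_ringKrullDim (R := A ⧸ K)]
      exact sally_len_le_supportDim rs h
    have hle' := hle _ hGreg
    obtain ⟨D, hD⟩ := WithBot.ne_bot_iff_exists.mp
      (fun h : ringKrullDim (A ⧸ K) = ⊥ ↦ by rw [h] at hle'; simp at hle')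
    rw [← hD]
    refine WithBot.coe_le_coe.mpr (sSup_le ?_)
    rintro _ ⟨rs, rfl, -, h⟩
    have := hle rs h
    rw [← hD] at this
    exact_mod_cast this
  · refine hdimle.trans ?_
    have : (d : ℕ∞) ≤ rdepth (A ⧸ K) (MG.map (Ideal.Quotient.mk K)) (A ⧸ K) := by
      refine le_sSup ⟨_, ?_, ?_, hGreg⟩
      · simp
      · intro x hx
        obtain ⟨i, rfl⟩ := List.mem_ofFn.mp hx
        refine Ideal.mem_map_of_mem _ ((hMG _).mpr ?_)
        rw [hg]
        simp [Polynomial.coeff_monomial]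
    exact_mod_cast this
end

section
/- Let (R,m) be Cohen-Macaulay local of dimension d > 0 with J = (x₁,...,x_d) generated by a regular sequence. Then for all n ≥ 1, the length of the socle of R/J^n satisfies λ((J^n : m)/J^n) = t(R)·C(n+d−2, d−1), where t(R) is the Cohen-Macaulay type of R. -/
set_option synthInstance.maxHeartbeats 1000000
set_option maxHeartbeats 2000000

open IsLocalRing Polynomial Finset

variable {R : Type*}

/-- Elementwise form of: `I ^ k / I ^ (k+1)` is free over `R / I` of rank `N`. -/
def GrFree {A : Type*} [CommRing A] (I : Ideal A) (k N : ℕ) : Prop :=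
  ∃ b : Fin N → A, (∀ i, b i ∈ I ^ k) ∧
    (∀ a ∈ I ^ k, ∃ c : Fin N → A, a = ∑ i, c i * b i) ∧
    (∀ c : Fin N → A, ∑ i, c i * b i ∈ I ^ (k + 1) → ∀ i, c i ∈ I)

lemma pow_decomp {A : Type*} [CommRing A] (I : Ideal A) (x : A) (k : ℕ) :
    (I ⊔ Ideal.span {x}) ^ (k + 1) ≤
      Ideal.span {x} * (I ⊔ Ideal.span {x}) ^ k ⊔ I ^ (k + 1) := by
  induction k with
  | zero => simp [sup_comm]
  | succ k ih =>
    have h1 : I * (I ⊔ Ideal.span {x}) ^ (k + 1) ≤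
        Ideal.span {x} * (I ⊔ Ideal.span {x}) ^ (k + 1) ⊔ I ^ (k + 1 + 1) := by
      refine (Ideal.mul_mono_right ih).trans ?_
      rw [Ideal.mul_sup]
      refine sup_le_sup ?_ ?_
      · rw [mul_left_comm, pow_succ' (I ⊔ Ideal.span {x}) k]
        exact Ideal.mul_mono_right (Ideal.mul_mono_left le_sup_left)
      · rw [pow_succ' I (k + 1)]
    calc (I ⊔ Ideal.span {x}) ^ (k + 1 + 1)
        = I * (I ⊔ Ideal.span {x}) ^ (k + 1)
          ⊔ Ideal.span {x} * (I ⊔ Ideal.span {x}) ^ (k + 1) := by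
            rw [pow_succ' _ (k + 1), Ideal.sup_mul]
      _ ≤ _ := sup_le h1 le_sup_left

lemma mem_pow_decomp {A : Type*} [CommRing A] {I : Ideal A} {x : A} {k : ℕ} {a : A}
    (ha : a ∈ (I ⊔ Ideal.span {x}) ^ (k + 1)) :
    ∃ h ∈ (I ⊔ Ideal.span {x}) ^ k, ∃ g ∈ I ^ (k + 1), a = x * h + g := by
  obtain ⟨y, hy, g, hg, rfl⟩ := Submodule.mem_sup.1 (pow_decomp I x k ha)
  obtain ⟨h, hh, rfl⟩ := Ideal.mem_span_singleton_mul.1 hy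
  exact ⟨h, hh, g, hg, rfl⟩

lemma reg_mod_pow {A : Type*} [CommRing A] {I : Ideal A} {x : A}
    (hI : ∀ k, ∃ N, GrFree I k N) (hx : ∀ a, x * a ∈ I → a ∈ I) (k : ℕ) :
    ∀ a, x * a ∈ I ^ k → a ∈ I ^ k := by
  induction k with
  | zero => simp
  | succ k ih =>
    intro a ha
    have h1 := ih a (Ideal.pow_le_pow_right (Nat.le_succ k) ha)
    obtain ⟨N, b, hb, hs, hi⟩ := hI k
    obtain ⟨c, rfl⟩ := hs a h1
    have h2 := hi (fun i => x * c i) (by simpa [Finset.mul_sum, mul_assoc] using ha)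
    rw [pow_succ']
    exact Ideal.sum_mem _ fun i _ => Ideal.mul_mem_mul (hx _ (h2 i)) (hb i)

lemma colon_x {A : Type*} [CommRing A] {I : Ideal A} {x : A}
    (hI : ∀ k, ∃ N, GrFree I k N) (hx : ∀ a, x * a ∈ I → a ∈ I) (k : ℕ) (a : A)
    (ha : x * a ∈ (I ⊔ Ideal.span {x}) ^ (k + 1)) : a ∈ (I ⊔ Ideal.span {x}) ^ k := by
  obtain ⟨h, hh, g, hg, e⟩ := mem_pow_decomp ha
  have h1 : x * (a - h) ∈ I ^ (k + 1) := by
    have : x * (a - h) = g := by rw [mul_sub, e]; ring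
    rwa [this]
  have h2 := reg_mod_pow hI hx _ _ h1
  have h3 : a - h ∈ (I ⊔ Ideal.span {x}) ^ k :=
    Ideal.pow_right_mono le_sup_left k (Ideal.pow_le_pow_right (Nat.le_succ k) h2)
  simpa using Ideal.add_mem _ h3 hh

lemma grFree_step {A : Type*} [CommRing A] {I : Ideal A} {x : A} {k M N : ℕ}
    (hI : ∀ k, ∃ N, GrFree I k N) (hx : ∀ a, x * a ∈ I → a ∈ I)
    (h1 : GrFree I (k + 1) M) (h2 : GrFree (I ⊔ Ideal.span {x}) k N) :
    GrFree (I ⊔ Ideal.span {x}) (k + 1) (M + N) := by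
  obtain ⟨b, hb, hs, hi⟩ := h1
  obtain ⟨b', hb', hs', hi'⟩ := h2
  have hxJ : x ∈ I ⊔ Ideal.span {x} :=
    Ideal.mem_sup_right (Ideal.mem_span_singleton_self x)
  have hIJ : ∀ n, I ^ n ≤ (I ⊔ Ideal.span {x}) ^ n := fun n => Ideal.pow_right_mono le_sup_left n
  refine ⟨Fin.append b (fun i => x * b' i), ?_, ?_, ?_⟩
  · intro i
    refine Fin.addCases (fun i => ?_) (fun i => ?_) i
    · simpa using hIJ _ (hb i)
    · simpa [pow_succ'] using Ideal.mul_mem_mul hxJ (hb' i)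
  · intro a ha
    obtain ⟨h, hh, g, hg, rfl⟩ := mem_pow_decomp ha
    obtain ⟨c, rfl⟩ := hs g hg
    obtain ⟨c', rfl⟩ := hs' h hh
    refine ⟨Fin.append c c', ?_⟩
    simp [Fin.sum_univ_add, Finset.mul_sum, mul_left_comm, add_comm]
  · intro c hc
    simp only [Fin.sum_univ_add, Fin.append_left, Fin.append_right] at hc
    obtain ⟨h, hh, g, hg, e⟩ := mem_pow_decomp hc
    have hS : ∑ i, c (Fin.natAdd M i) * (x * b' i) = x * ∑ i, c (Fin.natAdd M i) * b' i := by
      simp [Finset.mul_sum, mul_left_comm]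
    rw [hS] at e
    set S := ∑ i, c (Fin.natAdd M i) * b' i with hSdef
    set T := ∑ i, c (Fin.castAdd N i) * b i with hTdef
    have hT : T ∈ I ^ (k + 1) := Ideal.sum_mem _ fun i _ => Ideal.mul_mem_left _ _ (hb i)
    have hg' : g ∈ I ^ (k + 1) := Ideal.pow_le_pow_right (Nat.le_succ _) hg
    have hu : S - h ∈ I ^ (k + 1) := by
      apply reg_mod_pow hI hx
      have : x * (S - h) = g - T := by linear_combination e
      rw [this]
      exact Ideal.sub_mem _ hg' hT
    have hSJ : S ∈ (I ⊔ Ideal.span {x}) ^ (k + 1) := by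
      have := Ideal.add_mem _ (hIJ _ hu) hh
      simpa using this
    have hcN := hi' _ hSJ
    obtain ⟨f, hf⟩ := hs _ hu
    have hcM := hi (fun i => c (Fin.castAdd N i) + x * f i) (by
      have : ∑ i, (c (Fin.castAdd N i) + x * f i) * b i = g := by
        simp only [add_mul, Finset.sum_add_distrib, mul_assoc, ← Finset.mul_sum]
        rw [← hf, ← hTdef]
        linear_combination e
      rw [this]
      exact hg)
    intro i
    refine Fin.addCases (fun i => ?_) (fun i => ?_) i
    · have h3 := Ideal.sub_mem _ (Ideal.mem_sup_left (T := Ideal.span {x}) (hcM i))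
        (Ideal.mul_mem_right (f i) _ hxJ)
      simpa using h3
    · exact hcN i

lemma grFree_zero {A : Type*} [CommRing A] (I : Ideal A) : GrFree I 0 1 := by
  refine ⟨fun _ => 1, by simp, fun a _ => ⟨fun _ => a, by simp⟩, fun c hc i => ?_⟩
  have : i = 0 := Subsingleton.elim _ _
  subst this
  simpa using hc

lemma grFree_ofList {A : Type*} [CommRing A] (s : List A)
    (hs : RingTheory.Sequence.IsWeaklyRegular A s) :
    ∀ k, GrFree (Ideal.ofList s) k (Nat.multichoose s.length k) := by
  induction s using List.reverseRecOn with
  | nil =>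
    intro k
    cases k with
    | zero => simpa using grFree_zero _
    | succ k =>
      simp only [List.length_nil, Nat.multichoose_zero_succ]
      refine ⟨fun _ => 0, by simp, fun a ha => ⟨fun _ => 0, ?_⟩, fun c _ i => i.elim0⟩
      simpa using ha
  | append_singleton s x ih =>
    rw [RingTheory.Sequence.isWeaklyRegular_append_iff,
      RingTheory.Sequence.isWeaklyRegular_singleton_iff,
      isSMulRegular_quotient_iff_mem_of_smul_mem] at hs
    have ih' := ih hs.1
    have hx : ∀ a, x * a ∈ Ideal.ofList s → a ∈ Ideal.ofList s := by
      simpa using hs.2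
    rw [Ideal.ofList_append, Ideal.ofList_singleton]
    intro k
    induction k with
    | zero => simpa using grFree_zero _
    | succ k ihk =>
      rw [List.length_append, List.length_singleton] at ihk ⊢
      rw [Nat.multichoose_succ_succ]
      exact grFree_step (fun k => ⟨_, ih' k⟩) hx (ih' _) ihk

lemma colon_ofList {A : Type*} [CommRing A] [IsLocalRing A] (s : List A) (h0 : 0 < s.length)
    (hs : RingTheory.Sequence.IsWeaklyRegular A s) (hsm : ∀ x ∈ s, x ∈ maximalIdeal A)
    (k : ℕ) (a : A) (ha : ∀ r ∈ maximalIdeal A, r * a ∈ Ideal.ofList s ^ (k + 1)) :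
    a ∈ Ideal.ofList s ^ k := by
  induction s using List.reverseRecOn with
  | nil => simp at h0
  | append_singleton s x ih =>
    rw [RingTheory.Sequence.isWeaklyRegular_append_iff,
      RingTheory.Sequence.isWeaklyRegular_singleton_iff,
      isSMulRegular_quotient_iff_mem_of_smul_mem] at hs
    have hx : ∀ a, x * a ∈ Ideal.ofList s → a ∈ Ideal.ofList s := by
      simpa using hs.2
    rw [Ideal.ofList_append, Ideal.ofList_singleton] at ha ⊢
    exact colon_x (fun k => ⟨_, grFree_ofList s hs.1 k⟩) hx k a (ha x (hsm x (by simp)))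

lemma length_socle {A : Type*} [CommRing A] (I m : Ideal A) (k N : ℕ)
    (hG : GrFree I k N)
    (hcol : ∀ a, (∀ r ∈ m, r * a ∈ I ^ (k + 1)) → a ∈ I ^ k) :
    Module.length A (idealQuot ((I ^ (k + 1)).colon (m : Set A)) (I ^ (k + 1))) =
      N * Module.length A (idealQuot (I.colon (m : Set A)) I) := by
  classical
  obtain ⟨b, hb, hs, hi⟩ := hG
  let f : (Fin N → I.colon (m : Set A)) →ₗ[A] (I ^ (k + 1)).colon (m : Set A) :=
    LinearMap.codRestrict _
      (∑ i, (LinearMap.mulRight A (b i)) ∘ₗ (I.colon (m : Set A)).subtype ∘ₗ LinearMap.proj i)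
      (by
        intro c
        rw [Submodule.mem_colon]
        intro r hr
        simp only [LinearMap.sum_apply, smul_eq_mul, LinearMap.comp_apply, Finset.sum_mul]
        refine Ideal.sum_mem _ fun i _ => ?_
        have h1 := Submodule.mem_colon.1 (c i).2 r hr
        have h2 := Ideal.mul_mem_mul h1 (hb i)
        rw [pow_succ']
        convert h2 using 1
        simp
        ring)
  have hf : ∀ c, (f c : A) = ∑ i, (c i : A) * b i := by
    intro c
    simp [f]
  let K := Submodule.comap ((I ^ (k + 1)).colon (m : Set A)).subtype (I ^ (k + 1))
  let g := K.mkQ ∘ₗ f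
  have hg : Function.Surjective g := by
    refine (Submodule.mkQ_surjective K).comp ?_
    rintro ⟨a, ha⟩
    rw [Submodule.mem_colon] at ha
    obtain ⟨c, hc⟩ := hs a (hcol a fun r hr => by simpa [mul_comm] using ha r hr)
    refine ⟨fun i => ⟨c i, ?_⟩, Subtype.ext ?_⟩
    · rw [Submodule.mem_colon]
      intro r hr
      have := hi (fun i => r * c i) (by
        have := ha r hr
        rw [hc] at this
        simpa [Finset.mul_sum, mul_assoc, mul_comm _ r] using this) i
      simpa [mul_comm] using this
    · rw [hf]
      exact hc.symm
  let P : Submodule A (Fin N → I.colon (m : Set A)) :=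
    Submodule.pi Set.univ (fun _ => Submodule.comap (I.colon (m : Set A)).subtype I)
  have hker : LinearMap.ker g = P := by
    ext c
    rw [LinearMap.mem_ker]
    change K.mkQ (f c) = 0 ↔ _
    rw [Submodule.mkQ_apply, Submodule.Quotient.mk_eq_zero]
    simp only [K, P, Submodule.mem_comap, Submodule.subtype_apply, hf, Submodule.mem_pi,
      Set.mem_univ, true_imp_iff]
    refine ⟨fun h i => hi _ h i, fun h => Ideal.sum_mem _ fun i _ => ?_⟩
    rw [pow_succ']
    exact Ideal.mul_mem_mul (h i) (hb i)
  have e1 := (g.quotKerEquivOfSurjective hg).length_eq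
  have e2 := (Submodule.quotEquivOfEq _ _ hker).length_eq
  have e3 := (Submodule.quotientPi
    (fun _ : Fin N => Submodule.comap (I.colon (m : Set A)).subtype I)).length_eq
  refine (e1.symm.trans (e2.trans (e3.trans ?_)))
  rw [Module.length_pi]
  simp

theorem socle_length_of_power_of_parameter_ideal
    (R : Type*) [CommRing R] [IsLocalRing R] [IsNoetherianRing R]
    (d : ℕ) (hd : 0 < d) (hdim : ringKrullDim R = d)
    (hCM : IsCMLocal R) (hres : Infinite (ResidueField R))
    (t : ℕ) (ht : CMTypeData R d t)
    -- `J` is generated by a maximal regular sequence contained in `m`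
    (s : List R) (hlen : s.length = d) (hsm : ∀ x ∈ s, x ∈ maximalIdeal R)
    (hreg : RingTheory.Sequence.IsRegular R s)
    (J : Ideal R) (hJ : J = Ideal.span {x | x ∈ s}) :
    ∀ n, 1 ≤ n →
      mlen R (idealQuot ((J ^ n).colon (maximalIdeal R)) (J ^ n)) =
        ((t * (n + d - 2).choose (d - 1) : ℕ) : WithBot ℕ∞) := by
  intro n hn
  obtain ⟨k, rfl⟩ : ∃ k, n = k + 1 := ⟨n - 1, by omega⟩
  have hJ' : J = Ideal.ofList s := hJ
  have h1 := length_socle J (maximalIdeal R) k (Nat.multichoose d k)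
    (by rw [hJ', ← hlen]; exact grFree_ofList s hreg.toIsWeaklyRegular k)
    (by rw [hJ']; exact colon_ofList s (by omega) hreg.toIsWeaklyRegular hsm k)
  have h2 := ht s hlen hsm hreg
  rw [← hJ] at h2
  unfold mlen at h2 ⊢
  rw [← Module.coe_length] at h2 ⊢
  have h3 : Module.length R (idealQuot (J.colon (maximalIdeal R : Set R)) J) = (t : ℕ∞) := by
    exact_mod_cast h2
  rw [h1, h3, Nat.multichoose_eq]
  have h4 : (d + k - 1).choose k = (k + 1 + d - 2).choose (d - 1) := by
    rw [show k + 1 + d - 2 = d + k - 1 by omega]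
    exact Nat.choose_symm_of_eq_add (by omega)
  rw [h4, mul_comm]
  push_cast
  rfl
end
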